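/- Fix r ≥ 2, ε > 0 and a strictly increasing sequence 0 = x_0 < x_1 < ⋯ < x_{r−1} = 1. If the tuple (Q_1,…,Q_{r−1}) minimizes the barrier-perturbed Crisanti–Sommers functional C_r^ε(Q̲) = C_r(x̲, Q̲) − (ε/2) Σ_{k=0}^{r−1} log det(Q_{k+1} − Q_k) over all tuples of symmetric positive semidefinite matrices whose increments Q_{k+1} − Q_k (0 ≤ k ≤ r−1, with Q_0 = 0, Q_r = Q) are positive definite, and if Λ := (Q − Q_{r−1})⁻¹ + ξ'(Q) − ξ'(Q_{r−1}) + ε E_{r−1}, then for every 1 ≤ p ≤ r−1 the minimizer satisfies D_p⁻¹ = Λ_p + ε Ē_p, where E_p = (1/(x_p − x_{p−1})) ((Q_{p+1} − Q_p)⁻¹ − (Q_p − Q_{p−1})⁻¹) for 1 ≤ p ≤ r−1, E_r = 0, and Ē_p = Σ_{k=p}^{r−1} x_k (E_{k+1} − E_k). -/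

import Mathlib

open Matrix BigOperators Filter MeasureTheory

noncomputable section

namespace SphericalSG

abbrev Mat (n : ℕ) := Matrix (Fin n) (Fin n) ℝ

variable {n : ℕ}

/-- Frobenius inner product `⟨A,B⟩ = tr(AB)`. -/
def ip (A B : Mat n) : ℝ := (A * B).trace

/-- Sum of all entries of a matrix. -/
def matSum (A : Mat n) : ℝ := ∑ i, ∑ j, A i j

/-- `ξ(A) = Σ_{p≥2} (β_p β_pᵀ) ⊙ A^{∘p}` (entrywise). -/
def xiM (β : ℕ → Fin n → ℝ) (A : Mat n) : Mat n :=
  Matrix.of fun i j => ∑' p : ℕ, β (p + 2) i * β (p + 2) j * A i j ^ (p + 2)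

/-- `ξ'(A) = Σ_{p≥2} p (β_p β_pᵀ) ⊙ A^{∘(p-1)}`. -/
def xi'M (β : ℕ → Fin n → ℝ) (A : Mat n) : Mat n :=
  Matrix.of fun i j => ∑' p : ℕ, ((p : ℝ) + 2) * (β (p + 2) i * β (p + 2) j * A i j ^ (p + 1))

/-- `ξ''(A) = Σ_{p≥2} p(p-1) (β_p β_pᵀ) ⊙ A^{∘(p-2)}`. -/
def xi''M (β : ℕ → Fin n → ℝ) (A : Mat n) : Mat n :=
  Matrix.of fun i j =>
    ∑' p : ℕ, ((p : ℝ) + 2) * ((p : ℝ) + 1) * (β (p + 2) i * β (p + 2) j * A i j ^ p)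

/-- `θ(A) = Σ_{p≥2} (p-1) (β_p β_pᵀ) ⊙ A^{∘p}`. -/
def thetaM (β : ℕ → Fin n → ℝ) (A : Mat n) : Mat n :=
  Matrix.of fun i j => ∑' p : ℕ, ((p : ℝ) + 1) * (β (p + 2) i * β (p + 2) j * A i j ^ (p + 2))

/-- `Λ_p = Λ - Σ_{k=p}^{r-1} x_k (ξ'(Q_{k+1}) - ξ'(Q_k))`, with `Λ_r = Λ`. -/
def Lam (β : ℕ → Fin n → ℝ) (x : ℕ → ℝ) (Qs : ℕ → Mat n) (Λ : Mat n) (r p : ℕ) : Mat n :=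
  Λ - ∑ k ∈ Finset.Ico p r, x k • (xi'M β (Qs (k + 1)) - xi'M β (Qs k))

/-- `D_p = Σ_{k=p}^{r-1} x_k (Q_{k+1} - Q_k)`. -/
def Dmat (x : ℕ → ℝ) (Qs : ℕ → Mat n) (r p : ℕ) : Mat n :=
  ∑ k ∈ Finset.Ico p r, x k • (Qs (k + 1) - Qs k)

/-- The discrete Parisi functional `𝒫_r(Λ, x̲, Q̲)`. -/
def Pfun (β : ℕ → Fin n → ℝ) (h : Fin n → ℝ) (Q : Mat n) (r : ℕ)
    (Λ : Mat n) (x : ℕ → ℝ) (Qs : ℕ → Mat n) : ℝ :=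
  (1 / 2) * (ip (vecMulVec h h) (Lam β x Qs Λ r 1)⁻¹ + ip Λ Q - (n : ℝ)
    - Real.log Λ.det
    + ∑ k ∈ Finset.Ico 1 r,
        (1 / x k) * Real.log ((Lam β x Qs Λ r (k + 1)).det / (Lam β x Qs Λ r k).det)
    + ip (xi'M β (Qs 1)) (Lam β x Qs Λ r 1)⁻¹
    - ∑ k ∈ Finset.Ico 1 r, x k * matSum (thetaM β (Qs (k + 1)) - thetaM β (Qs k)))

/-- The discrete Crisanti–Sommers functional `𝒞_r(x̲, Q̲)`. -/
def Cfun (β : ℕ → Fin n → ℝ) (h : Fin n → ℝ) (Q : Mat n) (r : ℕ)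
    (x : ℕ → ℝ) (Qs : ℕ → Mat n) : ℝ :=
  (1 / 2) * (ip (vecMulVec h h) (Dmat x Qs r 1)
    + (1 / x (r - 1)) * Real.log (Q - Qs (r - 1)).det
    - ∑ k ∈ Finset.Ico 1 (r - 1),
        (1 / x k) * Real.log ((Dmat x Qs r (k + 1)).det / (Dmat x Qs r k).det)
    + ip (Qs 1) (Dmat x Qs r 1)⁻¹
    + ∑ k ∈ Finset.Ico 1 r, x k * matSum (xiM β (Qs (k + 1)) - xiM β (Qs k)))

/-- A discrete path `(x̲, Q̲)` of order `r`:
`0 = x_0 ≤ x_1 ≤ ⋯ ≤ x_{r-1} ≤ 1` and `0 = Q_0 ⪯ Q_1 ⪯ ⋯ ⪯ Q_r = Q`. -/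
structure IsPath (Q : Mat n) (r : ℕ) (x : ℕ → ℝ) (Qs : ℕ → Mat n) : Prop where
  x0 : x 0 = 0
  xmono : ∀ k, k + 1 ≤ r - 1 → x k ≤ x (k + 1)
  xtop : x (r - 1) ≤ 1
  Q0 : Qs 0 = 0
  Qr : Qs r = Q
  inc : ∀ k < r, (Qs (k + 1) - Qs k).PosSemidef

/-- A tuple `(Q_1, …, Q_{r-1})` with positive definite increments,
`Q_0 = 0` and `Q_r = Q`. -/
structure IsStrictTuple (Q : Mat n) (r : ℕ) (Qs : ℕ → Mat n) : Prop where
  Q0 : Qs 0 = 0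
  Qr : Qs r = Q
  inc : ∀ k < r, (Qs (k + 1) - Qs k).PosDef

/-- A strictly increasing sequence `0 = x_0 < x_1 < ⋯ < x_{r-1} = 1`. -/
structure IsStrictSeq (r : ℕ) (x : ℕ → ℝ) : Prop where
  x0 : x 0 = 0
  xmono : ∀ k, k + 1 ≤ r - 1 → x k < x (k + 1)
  xtop : x (r - 1) = 1

/-- `Ē_p = Σ_{k=p}^{r-1} x_k (E_{k+1} - E_k)`. -/
def Ebar (x : ℕ → ℝ) (E : ℕ → Mat n) (r p : ℕ) : Mat n :=
  ∑ k ∈ Finset.Ico p r, x k • (E (k + 1) - E k)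

/-- The error matrices for the Parisi critical point, with entrywise division by `ξ''`:
`E_p = (1/(x_p - x_{p-1})) ((Q_{p+1}-Q_p)⁻¹ - (Q_p-Q_{p-1})⁻¹) ⊘ ξ''(Q_p)`
for `1 ≤ p ≤ r-1`, and `E_p = 0` otherwise (in particular `E_r = 0`). -/
def EP (β : ℕ → Fin n → ℝ) (x : ℕ → ℝ) (Qs : ℕ → Mat n) (r p : ℕ) : Mat n :=
  if 1 ≤ p ∧ p ≤ r - 1 then
    Matrix.of fun i j =>
      (1 / (x p - x (p - 1))) *
        ((((Qs (p + 1) - Qs p)⁻¹ - (Qs p - Qs (p - 1))⁻¹) i j) / xi''M β (Qs p) i j)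
  else 0

/-- The error matrices for the Crisanti–Sommers critical point:
`E_p = (1/(x_p - x_{p-1})) ((Q_{p+1}-Q_p)⁻¹ - (Q_p-Q_{p-1})⁻¹)` for `1 ≤ p ≤ r-1`,
and `E_p = 0` otherwise (in particular `E_r = 0`). -/
def EC (x : ℕ → ℝ) (Qs : ℕ → Mat n) (r p : ℕ) : Mat n :=
  if 1 ≤ p ∧ p ≤ r - 1 then
    (1 / (x p - x (p - 1))) • ((Qs (p + 1) - Qs p)⁻¹ - (Qs p - Qs (p - 1))⁻¹)
  else 0

/-- The logarithmic barrier `Σ_{k=0}^{r-1} log det (Q_{k+1} - Q_k)`. -/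
def barrier (Qs : ℕ → Mat n) (r : ℕ) : ℝ :=
  ∑ k ∈ Finset.range r, Real.log ((Qs (k + 1) - Qs k).det)

/-- The barrier-perturbed Parisi functional `𝒫_r^ε`. -/
def PfunEps (β : ℕ → Fin n → ℝ) (h : Fin n → ℝ) (Q : Mat n) (r : ℕ) (ε : ℝ)
    (Λ : Mat n) (x : ℕ → ℝ) (Qs : ℕ → Mat n) : ℝ :=
  Pfun β h Q r Λ x Qs - (ε / 2) * barrier Qs r

/-- The barrier-perturbed Crisanti–Sommers functional `𝒞_r^ε`. -/
def CfunEps (β : ℕ → Fin n → ℝ) (h : Fin n → ℝ) (Q : Mat n) (r : ℕ) (ε : ℝ)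
    (x : ℕ → ℝ) (Qs : ℕ → Mat n) : ℝ :=
  Cfun β h Q r x Qs - (ε / 2) * barrier Qs r

/-- `D_p(ε) = D_p + ε Ē_p` (with the `EP` errors). -/
def DE (β : ℕ → Fin n → ℝ) (x : ℕ → ℝ) (Qs : ℕ → Mat n) (r : ℕ) (ε : ℝ) (p : ℕ) : Mat n :=
  Dmat x Qs r p + ε • Ebar x (EP β x Qs r) r p

/-- `Λ_p(ε) = Λ_p + ε Ē_p` (with the `EC` errors). -/
def LE (β : ℕ → Fin n → ℝ) (x : ℕ → ℝ) (Qs : ℕ → Mat n) (Λ : Mat n) (r : ℕ) (ε : ℝ)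
    (p : ℕ) : Mat n :=
  Lam β x Qs Λ r p + ε • Ebar x (EC x Qs r) r p

/-- The approximate Crisanti–Sommers functional `𝒞_r^ε(Q̲)` obtained from the
perturbed Parisi functional at its critical point. -/
def CfunEpsApprox (β : ℕ → Fin n → ℝ) (h : Fin n → ℝ) (r : ℕ) (ε : ℝ)
    (x : ℕ → ℝ) (Qs : ℕ → Mat n) : ℝ :=
  (1 / 2) * (ip (vecMulVec h h) (DE β x Qs r ε 1)
    + (1 / x (r - 1)) * Real.log (DE β x Qs r ε (r - 1)).det
    - ∑ k ∈ Finset.Ico 1 (r - 1),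
        (1 / x k) * Real.log ((DE β x Qs r ε (k + 1)).det / (DE β x Qs r ε k).det)
    + ip (Qs 1) (DE β x Qs r ε 1)⁻¹
    + ∑ k ∈ Finset.Ico 1 r, x k * matSum (xiM β (Qs (k + 1)) - xiM β (Qs k))
    - ε * ∑ k ∈ Finset.Ico 1 (r - 1),
        ip (Ebar x (EP β x Qs r) r (k + 1) - Ebar x (EP β x Qs r) r k) (xi'M β (Qs (k + 1)))
    - ∑ k ∈ Finset.Ico 1 (r - 1),
        (ε / x k) * ip (DE β x Qs r ε (k + 1))⁻¹
          (Ebar x (EP β x Qs r) r k - Ebar x (EP β x Qs r) r (k + 1))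
    - ε * ip (DE β x Qs r ε (r - 1))⁻¹ (Ebar x (EP β x Qs r) r (r - 1))
    + ε * ip (xi'M β (Qs (r - 1))) (Ebar x (EP β x Qs r) r (r - 1))
    - ε * barrier Qs r)

/-- The approximate Parisi functional `𝒫_r^ε(Λ, Q̲)` obtained from the
perturbed Crisanti–Sommers functional at its critical point. -/
def PfunEpsApprox (β : ℕ → Fin n → ℝ) (h : Fin n → ℝ) (Q : Mat n) (r : ℕ) (ε : ℝ)
    (Λ : Mat n) (x : ℕ → ℝ) (Qs : ℕ → Mat n) : ℝ :=
  (1 / 2) * (ip Λ Q - (n : ℝ) - Real.log Λ.det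
    + ∑ k ∈ Finset.Ico 1 r,
        (1 / x k) * Real.log ((LE β x Qs Λ r ε (k + 1)).det / (LE β x Qs Λ r ε k).det)
    + ip (LE β x Qs Λ r ε 1)⁻¹ (vecMulVec h h + xi'M β (Qs 1))
    - ∑ k ∈ Finset.Ico 1 r, x k * matSum (thetaM β (Qs (k + 1)) - thetaM β (Qs k))
    - ε * ∑ k ∈ Finset.Ico 1 (r - 1),
        ip (Ebar x (EC x Qs r) r (k + 1) - Ebar x (EC x Qs r) r k) (Qs k)
    + ∑ k ∈ Finset.Ico 1 (r - 1),
        (ε / x k) * ip (LE β x Qs Λ r ε k)⁻¹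
          (Ebar x (EC x Qs r) r k - Ebar x (EC x Qs r) r (k + 1))
    + ε * ip (LE β x Qs Λ r ε (r - 1))⁻¹ (Ebar x (EC x Qs r) r (r - 1))
    + ε * ip (Qs (r - 1)) (Ebar x (EC x Qs r) r (r - 1))
    - ε * barrier Qs r)

/-! Continuous-time objects -/

/-- The entrywise derivative `Φ'(t)`. -/
def phiD (Φ : ℝ → Mat n) (t : ℝ) : Mat n := Matrix.of fun i j => deriv (fun s => Φ s i j) t

/-- `Φ̂(t) = ∫_t^n x(s) Φ'(s) ds` (entrywise). -/
def phiHat (x : ℝ → ℝ) (Φ : ℝ → Mat n) (t : ℝ) : Mat n :=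
  Matrix.of fun i j => ∫ s in t..(n : ℝ), x s * phiD Φ s i j

/-- `t_x = inf { t ∈ [0, n] : x(t) ≥ 1 }`. -/
def txx (nR : ℝ) (x : ℝ → ℝ) : ℝ := sInf {t : ℝ | t ∈ Set.Icc 0 nR ∧ 1 ≤ x t}

/-- The Crisanti–Sommers functional `𝒞(x, Φ)` in integral form. -/
def Ccont (β : ℕ → Fin n → ℝ) (h : Fin n → ℝ) (Q : Mat n)
    (x : ℝ → ℝ) (Φ : ℝ → Mat n) : ℝ :=
  (1 / 2) * ((∫ t in (0:ℝ)..(n : ℝ), x t * ip (xi'M β (Φ t) + vecMulVec h h) (phiD Φ t))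
    + Real.log (Q - Φ (txx (n : ℝ) x)).det
    + ∫ t in (0:ℝ)..(txx (n : ℝ) x), ip (phiHat x Φ t)⁻¹ (phiD Φ t))

/-- An admissible monotone matrix path `Φ` parametrized by its trace. -/
structure AdmPath (Q : Mat n) (Φ : ℝ → Mat n) : Prop where
  zero : Φ 0 = 0
  top : Φ (n : ℝ) = Q
  tr : ∀ t ∈ Set.Icc (0:ℝ) (n : ℝ), (Φ t).trace = t
  psd : ∀ t ∈ Set.Icc (0:ℝ) (n : ℝ), (Φ t).PosSemidef
  mono : ∀ s t : ℝ, s ∈ Set.Icc (0:ℝ) (n : ℝ) → t ∈ Set.Icc (0:ℝ) (n : ℝ) → s ≤ t →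
    (Φ t - Φ s).PosSemidef
  lip : ∀ i j, LipschitzOnWith 1 (fun t => Φ t i j) (Set.Icc (0:ℝ) (n : ℝ))

/-- An admissible c.d.f.: right-continuous, nondecreasing, from `[0,n]` to `[0,1]`,
with `x(0) = 0` and `x(n) = 1`. -/
structure AdmCDF (n : ℕ) (x : ℝ → ℝ) : Prop where
  zero : x 0 = 0
  top : x (n : ℝ) = 1
  mono : MonotoneOn x (Set.Icc (0:ℝ) (n : ℝ))
  mem : ∀ t ∈ Set.Icc (0:ℝ) (n : ℝ), x t ∈ Set.Icc (0:ℝ) 1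
  rightCont : ∀ t ∈ Set.Ico (0:ℝ) (n : ℝ), ContinuousWithinAt x (Set.Ici t) t

/-- An admissible pair `(x, Φ)` with `det(Q - Φ(t_x)) > 0`. -/
def AdmPair (Q : Mat n) (x : ℝ → ℝ) (Φ : ℝ → Mat n) : Prop :=
  AdmCDF n x ∧ AdmPath Q Φ ∧ 0 < (Q - Φ (txx (n : ℝ) x)).det

/-- Membership in the set `A_{T,L}`. -/
def ATL (Q : Mat n) (T L : ℝ) (x : ℝ → ℝ) (Φ : ℝ → Mat n) : Prop :=
  AdmPair Q x Φ ∧ (∀ t : ℝ, T ≤ t → t ≤ (n : ℝ) → x t = 1) ∧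
    ∀ i j, |(Q - Φ (txx (n : ℝ) x))⁻¹ i j| ≤ L

end SphericalSG

namespace SphericalSG



theorem aux_logdet {n : ℕ} (A H : Mat n) (hA : A.PosDef) :
    HasDerivAt (fun t : ℝ => Real.log (A + t • H).det) (ip A⁻¹ H) 0 := by
  have hdet : A.det ≠ 0 := hA.det_pos.ne'
  have hu : IsUnit A.det := isUnit_iff_ne_zero.mpr hdet
  have e : ∀ t : ℝ, (A + t • H).det = A.det * (1 + t • (A⁻¹ * H)).det := by
    intro t
    rw [← Matrix.det_mul]
    congr 1
    rw [Matrix.mul_add, Matrix.mul_one, Matrix.mul_smul, ← Matrix.mul_assoc,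
      Matrix.mul_nonsing_inv _ hu, Matrix.one_mul]
  have hd : HasDerivAt (fun t : ℝ => (A + t • H).det) (A.det * (A⁻¹ * H).trace) 0 := by
    rw [show (fun t : ℝ => (A + t • H).det) = fun t : ℝ => A.det * (1 + (A⁻¹ * H).trace * t +
      (det (1 + (Polynomial.X : Polynomial ℝ) • (A⁻¹ * H).map Polynomial.C)).divX.divX.eval t
        * t ^ 2) from funext fun t => by rw [e, Matrix.det_one_add_smul]]
    refine HasDerivAt.const_mul _ ?_
    set P := (det (1 + (Polynomial.X : Polynomial ℝ) • (A⁻¹ * H).map Polynomial.C)).divX.divX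
    have h1 := (((hasDerivAt_id (0:ℝ)).const_mul (A⁻¹ * H).trace).const_add 1).add
      ((P.hasDerivAt (0:ℝ)).mul (hasDerivAt_pow 2 (0:ℝ)))
    refine h1.congr_deriv ?_
    simp
  have h2 := hd.log (by simpa using hdet)
  refine h2.congr_deriv ?_
  simp [ip]
  field_simp

theorem aux_posDef {n : ℕ} (A H : Mat n) (hA : A.PosDef) (hH : H.IsHermitian) :
    ∀ᶠ t : ℝ in nhds 0, (A + t • H).PosDef := by
  have hc : IsCompact (Metric.sphere (0 : Fin n → ℝ) 1) := isCompact_sphere _ _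
  have hF : Continuous (fun q : ℝ × (Fin n → ℝ) => q.2 ⬝ᵥ ((A + q.1 • H) *ᵥ q.2)) := by
    fun_prop
  have key : ∀ᶠ t : ℝ in nhds 0, ∀ v ∈ Metric.sphere (0 : Fin n → ℝ) 1,
      0 < v ⬝ᵥ ((A + t • H) *ᵥ v) := by
    refine hc.eventually_forall_of_forall_eventually ?_
    intro v hv
    refine hF.continuousAt.eventually (lt_mem_nhds ?_)
    have hv0 : v ≠ 0 := by
      rintro rfl; simp at hv
    simpa using hA.dotProduct_mulVec_pos hv0
  filter_upwards [key] with t ht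
  refine Matrix.PosDef.of_dotProduct_mulVec_pos ?_ ?_
  · refine hA.isHermitian.add ?_
    rw [Matrix.IsHermitian, Matrix.conjTranspose_smul, hH.eq]; simp
  · intro v hv
    have hn : 0 < ‖v‖ := norm_pos_iff.mpr hv
    have h1 := ht (‖v‖⁻¹ • v) (by simp [norm_smul, hn.ne'])
    rw [Matrix.mulVec_smul, dotProduct_smul, smul_dotProduct, smul_smul, smul_eq_mul] at h1
    have h2 : 0 < ‖v‖⁻¹ * ‖v‖⁻¹ := by positivity
    simpa using pos_of_mul_pos_right h1 h2.le

theorem aux_summable {n : ℕ} (β : ℕ → Fin n → ℝ)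
    (hβsum : ∀ j, Summable fun p : ℕ => (2:ℝ) ^ p * β p j ^ 2) (i j : Fin n) :
    Summable fun p : ℕ => (2:ℝ) ^ (p+2) * |β (p+2) i * β (p+2) j| := by
  have h0 := ((hβsum i).add (hβsum j))
  have h1 := (summable_nat_add_iff 2).mpr h0
  refine Summable.of_nonneg_of_le (fun p => by positivity) (fun p => ?_) h1
  have : |β (p+2) i * β (p+2) j| ≤ β (p+2) i ^ 2 + β (p+2) j ^ 2 := by
    rw [abs_le]; constructor <;> nlinarith [sq_nonneg (β (p+2) i + β (p+2) j),
      sq_nonneg (β (p+2) i - β (p+2) j), sq_nonneg (β (p+2) i), sq_nonneg (β (p+2) j)]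
  rw [← mul_add]
  gcongr

theorem aux_series (a : ℕ → ℝ) (ha : Summable fun p : ℕ => (2:ℝ) ^ (p+2) * |a p|)
    (s : ℝ) (hs : |s| ≤ 1) :
    HasDerivAt (fun z : ℝ => ∑' p : ℕ, a p * z ^ (p+2))
      (∑' p : ℕ, ((p:ℝ)+2) * (a p * s ^ (p+1))) s := by
  have hb : ∀ p : ℕ, ((p:ℝ)+2) * (3/2:ℝ) ^ (p+1) ≤ 4 * 2 ^ (p+2) := by
    intro p
    have h1 : 1 + ((p:ℝ)+2) * (1/3) ≤ (1 + 1/3 : ℝ) ^ (p+2) := by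
      have := one_add_mul_le_pow (a := (1/3:ℝ)) (by norm_num) (p+2)
      push_cast at this
      exact this
    have h2 : (2:ℝ)^(p+2) = (3/2)^(p+2) * (1+1/3)^(p+2) := by
      rw [← mul_pow]; norm_num
    rw [h2, pow_succ (3/2:ℝ) (p+1)]
    have h3 : (0:ℝ) < (3/2)^(p+1) := by positivity
    have h4 : (0:ℝ) ≤ p := by positivity
    nlinarith [mul_le_mul_of_nonneg_left h1 h3.le]
  refine hasDerivAt_tsum_of_isPreconnected (t := Metric.ball (0:ℝ) (3/2)) (y₀ := 0)
    (u := fun p => 4 * (2 ^ (p+2) * |a p|))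
    (g' := fun p y => ((p:ℝ)+2) * (a p * y ^ (p+1))) (ha.mul_left 4) Metric.isOpen_ball
    (convex_ball _ _).isPreconnected ?_ ?_ (by simp) ?_ ?_
  · intro p y _
    refine ((hasDerivAt_pow (p+2) y).const_mul (a p)).congr_deriv ?_
    push_cast
    ring
  · intro p y hy
    have hy' : |y| ≤ 3/2 := by simpa using (mem_ball_zero_iff.mp hy).le
    rw [Real.norm_eq_abs, abs_mul, abs_mul, abs_pow, abs_of_nonneg (by positivity : (0:ℝ) ≤ (p:ℝ)+2)]
    have h1 : |y|^(p+1) ≤ (3/2)^(p+1) := pow_le_pow_left₀ (abs_nonneg _) hy' _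
    calc ((p:ℝ)+2) * (|a p| * |y|^(p+1)) ≤ ((p:ℝ)+2) * (|a p| * (3/2)^(p+1)) := by gcongr
      _ = (((p:ℝ)+2) * (3/2)^(p+1)) * |a p| := by ring
      _ ≤ (4 * 2^(p+2)) * |a p| := mul_le_mul_of_nonneg_right (hb p) (abs_nonneg _)
      _ = _ := by ring
  · simp
  · rw [mem_ball_zero_iff, Real.norm_eq_abs]; linarith

theorem aux_xi {n : ℕ} (β : ℕ → Fin n → ℝ)
    (hβsum : ∀ j, Summable fun p : ℕ => (2:ℝ) ^ p * β p j ^ 2)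
    (A H : Mat n) (hA : ∀ i j, |A i j| ≤ 1) (hH : H.IsHermitian) :
    HasDerivAt (fun t : ℝ => matSum (xiM β (A + t • H))) (ip (xi'M β A) H) 0 := by
  have h1 : ip (xi'M β A) H = ∑ i, ∑ j, xi'M β A i j * H i j := by
    simp only [ip, Matrix.trace, Matrix.diag, Matrix.mul_apply]
    refine Finset.sum_congr rfl fun i _ => Finset.sum_congr rfl fun j _ => ?_
    rw [show H j i = H i j by simpa using hH.apply i j]
  rw [h1]
  unfold matSum
  refine HasDerivAt.fun_sum fun i _ => HasDerivAt.fun_sum fun j _ => ?_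
  have h2 := aux_series (fun p => β (p+2) i * β (p+2) j) (aux_summable β hβsum i j) (A i j) (hA i j)
  have h3 : HasDerivAt (fun t : ℝ => A i j + t * H i j) (H i j) 0 := by
    simpa using ((hasDerivAt_id (0:ℝ)).mul_const (H i j)).const_add (A i j)
  have h4 := HasDerivAt.comp (0:ℝ) (h₂ := fun z : ℝ => ∑' p : ℕ, β (p+2) i * β (p+2) j * z ^ (p+2))
    (h := fun t : ℝ => A i j + t * H i j) (by simpa using h2) h3
  exact h4

theorem aux_entry {n : ℕ} (Q A : Mat n) (hQdiag : ∀ i, Q i i = 1) (hA : A.PosSemidef)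
    (hQA : (Q - A).PosSemidef) (i j : Fin n) : |A i j| ≤ 1 := by
  have hd : ∀ i, A i i ≤ 1 := fun i => by
    have := hQA.diag_nonneg (i := i)
    simp [hQdiag] at this; exact this
  have hs : A j i = A i j := by simpa using hA.isHermitian.apply i j
  by_cases hij : i = j
  · subst hij
    rw [abs_of_nonneg hA.diag_nonneg]; exact hd i
  have q : ∀ c : ℝ, 0 ≤ A i i + 2 * c * A i j + c^2 * A j j := by
    intro c
    have := hA.dotProduct_mulVec_nonneg (Pi.single i 1 + c • Pi.single j 1)
    simp [Matrix.mulVec_add, Matrix.mulVec_smul, hs] at this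
    nlinarith
  have q1 := q 1
  have q2 := q (-1)
  rw [abs_le]
  constructor <;> nlinarith [hd i, hd j]

theorem aux_D_abel {n : ℕ} (x : ℕ → ℝ) (V : ℕ → Mat n) (j m : ℕ) (hm : j + 1 ≤ m) :
    ∑ k ∈ Finset.Ico j m, x k • (V (k+1) - V k)
      = x (m-1) • V m - x j • V j - ∑ k ∈ Finset.Ico (j+1) m, (x k - x (k-1)) • V k := by
  induction m, hm using Nat.le_induction with
  | base => simp [smul_sub]
  | succ m hm ih =>
    rw [Finset.sum_Ico_succ_top (by omega), ih, Finset.sum_Ico_succ_top (by omega)]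
    simp only [Nat.add_sub_cancel]
    module

theorem aux_abel1 (x L : ℕ → ℝ) (hx0 : x 0 = 0) (m : ℕ) (hm : 2 ≤ m) :
    1 / x (m-1) * L (m-1) - ∑ k ∈ Finset.Ico 1 (m-1), 1 / x k * (L (k+1) - L k)
      = ∑ k ∈ Finset.Ico 1 m, L k * (1 / x k - 1 / x (k-1)) := by
  induction m, hm using Nat.le_induction with
  | base => simp [hx0]; ring
  | succ m hm ih =>
    obtain ⟨m, rfl⟩ : ∃ q, m = q + 1 := ⟨m - 1, by omega⟩
    rw [Finset.sum_Ico_succ_top (by omega), ← ih]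
    simp only [Nat.add_sub_cancel]
    rw [Finset.sum_Ico_succ_top (by omega)]
    ring

theorem aux_abel2 (x G : ℕ → ℝ) (hx0 : x 0 = 0) (m : ℕ) (hm : 1 ≤ m) :
    ∑ k ∈ Finset.Ico 1 m, x k * (G (k+1) - G k)
      = x (m-1) * G m - ∑ k ∈ Finset.Ico 1 m, (x k - x (k-1)) * G k := by
  induction m, hm using Nat.le_induction with
  | base => simp [hx0]
  | succ m hm ih =>
    rw [Finset.sum_Ico_succ_top (by omega), ih, Finset.sum_Ico_succ_top (by omega)]
    simp only [Nat.add_sub_cancel]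
    ring

theorem aux_abel3 {n : ℕ} (B V : ℕ → Mat n) (h0 : V 0 = 0) (m : ℕ) (hm : 1 ≤ m) :
    ∑ k ∈ Finset.range m, ip (B k) (V (k+1) - V k)
      = ip (B (m-1)) (V m) - ∑ k ∈ Finset.Ico 1 m, ip (B k - B (k-1)) (V k) := by
  induction m, hm using Nat.le_induction with
  | base => simp [h0, ip]
  | succ m hm ih =>
    rw [Finset.sum_range_succ, ih, Finset.sum_Ico_succ_top (by omega)]
    simp only [Nat.add_sub_cancel, ip, Matrix.mul_sub, Matrix.sub_mul, Matrix.trace_sub]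
    ring

theorem aux_sum_two (f : ℕ → ℝ) (p r : ℕ) (hp : 1 ≤ p) (hpr : p + 1 < r)
    (hf : ∀ k, k ≠ p → k ≠ p + 1 → f k = 0) :
    ∑ k ∈ Finset.Ico 1 r, f k = f p + f (p+1) := by
  refine Finset.sum_eq_add p (p+1) (by omega) (fun c _ hc => hf c hc.1 hc.2) ?_ ?_
  · intro h; exact absurd (Finset.mem_Ico.mpr ⟨hp, by omega⟩) h
  · intro h; exact absurd (Finset.mem_Ico.mpr ⟨by omega, hpr⟩) h

theorem aux_x_pos {r : ℕ} {x : ℕ → ℝ} (hx : IsStrictSeq r x) :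
    ∀ k, 1 ≤ k → k ≤ r - 1 → 0 < x k := by
  intro k hk
  induction k, hk using Nat.le_induction with
  | base => intro h; have := hx.xmono 0 h; rw [hx.x0] at this; simpa using this
  | succ k hk ih => intro h; exact (ih (by omega)).trans (hx.xmono k h)

theorem aux_D_posDef {n : ℕ} {Q : Mat n} {r : ℕ} {x : ℕ → ℝ} {Qs : ℕ → Mat n}
    (hx : IsStrictSeq r x) (hQs : IsStrictTuple Q r Qs) (k : ℕ) (hk : 1 ≤ k) (hkr : k < r) :
    (Dmat x Qs r k).PosDef := by
  unfold Dmat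
  refine Matrix.posDef_sum ⟨k, by simp [hkr]⟩ ?_
  intro i hi
  rw [Finset.mem_Ico] at hi
  exact (hQs.inc i hi.2).smul (aux_x_pos hx i (by omega) (by omega))

theorem aux_Q_psd {n : ℕ} {Q : Mat n} {r : ℕ} {Qs : ℕ → Mat n}
    (hQs : IsStrictTuple Q r Qs) (a b : ℕ) (hab : a ≤ b) (hbr : b ≤ r) :
    (Qs b - Qs a).PosSemidef := by
  induction b, hab using Nat.le_induction with
  | base => simpa using Matrix.PosSemidef.zero
  | succ b hb ih =>
    have := (hQs.inc b (by omega)).posSemidef.add (ih (by omega))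
    simpa using this

theorem aux_Q_entry {n : ℕ} {Q : Mat n} {r : ℕ} {Qs : ℕ → Mat n}
    (hQdiag : ∀ i, Q i i = 1)
    (hQs : IsStrictTuple Q r Qs) (k : ℕ) (hk : k ≤ r) (i j : Fin n) : |Qs k i j| ≤ 1 := by
  refine aux_entry Q (Qs k) hQdiag ?_ ?_ i j
  · simpa [hQs.Q0] using aux_Q_psd hQs 0 k (by omega) hk
  · simpa [hQs.Qr] using aux_Q_psd hQs k r hk le_rfl

theorem aux_Dmat_line {n : ℕ} (x : ℕ → ℝ) (Qs V : ℕ → Mat n) (r k : ℕ) (t : ℝ) :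
    Dmat x (fun k => Qs k + t • V k) r k = Dmat x Qs r k + t • Dmat x V r k := by
  unfold Dmat
  rw [Finset.smul_sum, ← Finset.sum_add_distrib]
  refine Finset.sum_congr rfl fun i _ => ?_
  module

theorem aux_Dmat_herm {n : ℕ} (x : ℕ → ℝ) (V : ℕ → Mat n) (hV : ∀ k, (V k).IsHermitian) (r k : ℕ) :
    (Dmat x V r k).IsHermitian := by
  have h : ∀ k, (V k)ᴴ = V k := hV
  simp only [Dmat, Matrix.IsHermitian, Matrix.conjTranspose_sum, Matrix.conjTranspose_smul,
    Matrix.conjTranspose_sub, h, star_trivial]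

theorem aux_deriv {n : ℕ} (h : Fin n → ℝ) (β : ℕ → Fin n → ℝ)
    (hβsum : ∀ j, Summable fun p : ℕ => (2:ℝ) ^ p * β p j ^ 2)
    (Q : Mat n) (hQdiag : ∀ i, Q i i = 1)
    (r : ℕ) (hr : 2 ≤ r) (ε : ℝ)
    (x : ℕ → ℝ) (hx : IsStrictSeq r x)
    (Qs : ℕ → Mat n) (hQs : IsStrictTuple Q r Qs)
    (V : ℕ → Mat n) (hV : ∀ k, (V k).IsHermitian)
    (hW : Dmat x V r 1 = 0) :
    HasDerivAt (fun t : ℝ => CfunEps β h Q r ε x (fun k => Qs k + t • V k))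
      ((1/2) * (1 / x (r-1) * ip (Q - Qs (r-1))⁻¹ (- V (r-1))
        - ∑ k ∈ Finset.Ico 1 (r-1), 1 / x k * (ip (Dmat x Qs r (k+1))⁻¹ (Dmat x V r (k+1))
            - ip (Dmat x Qs r k)⁻¹ (Dmat x V r k))
        + ip (V 1) (Dmat x Qs r 1)⁻¹
        + ∑ k ∈ Finset.Ico 1 r, x k * (ip (xi'M β (Qs (k+1))) (V (k+1)) - ip (xi'M β (Qs k)) (V k)))
       - ε / 2 * ∑ k ∈ Finset.range r, ip (Qs (k+1) - Qs k)⁻¹ (V (k+1) - V k)) 0 := by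
  unfold CfunEps Cfun barrier
  simp_rw [aux_Dmat_line, hW, smul_zero, add_zero]
  refine HasDerivAt.sub (HasDerivAt.const_mul _ ?_) (HasDerivAt.const_mul _ ?_)
  · refine HasDerivAt.add (HasDerivAt.add (HasDerivAt.sub ?_ ?_) ?_) ?_
    · refine HasDerivAt.const_add _ (HasDerivAt.const_mul _ ?_)
      have hp : (Q - Qs (r-1)).PosDef := by
        have := hQs.inc (r-1) (by omega)
        rwa [show r - 1 + 1 = r by omega, hQs.Qr] at this
      have := aux_logdet _ (- V (r-1)) hp
      refine this.congr_of_eventuallyEq (Eventually.of_forall fun t => ?_)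
      simp only
      congr 2
      module
    · refine HasDerivAt.fun_sum fun k hk => HasDerivAt.const_mul _ ?_
      rw [Finset.mem_Ico] at hk
      have p1 := aux_D_posDef hx hQs (k+1) (by omega) (by omega)
      have p2 := aux_D_posDef hx hQs k (by omega) (by omega)
      have := (aux_logdet _ (Dmat x V r (k+1)) p1).sub (aux_logdet _ (Dmat x V r k) p2)
      refine this.congr_of_eventuallyEq ?_
      filter_upwards [aux_posDef _ _ p1 (aux_Dmat_herm x V hV r (k+1)),
        aux_posDef _ _ p2 (aux_Dmat_herm x V hV r k)] with t h1 h2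
      exact Real.log_div h1.det_pos.ne' h2.det_pos.ne'
    · simp only [ip, Matrix.add_mul, Matrix.smul_mul, Matrix.trace_add, Matrix.trace_smul, smul_eq_mul]
      simpa using ((hasDerivAt_id (0:ℝ)).mul_const
        (V 1 * (Dmat x Qs r 1)⁻¹).trace).const_add (Qs 1 * (Dmat x Qs r 1)⁻¹).trace
    · refine HasDerivAt.fun_sum fun k hk => HasDerivAt.const_mul _ ?_
      rw [Finset.mem_Ico] at hk
      have := (aux_xi β hβsum (Qs (k+1)) (V (k+1))
        (aux_Q_entry hQdiag hQs (k+1) (by omega)) (hV _)).sub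
        (aux_xi β hβsum (Qs k) (V k) (aux_Q_entry hQdiag hQs k (by omega)) (hV _))
      refine this.congr_of_eventuallyEq (Eventually.of_forall fun t => ?_)
      simp [matSum]
  · refine HasDerivAt.fun_sum fun k hk => ?_
    have := aux_logdet _ (V (k+1) - V k) (hQs.inc k (Finset.mem_range.mp hk))
    refine this.congr_of_eventuallyEq (Eventually.of_forall fun t => ?_)
    simp only
    congr 2
    module

theorem ip_add_left {n : ℕ} (A B C : Mat n) : ip (A + B) C = ip A C + ip B C := by
  simp [ip, Matrix.add_mul]

theorem ip_sub_left {n : ℕ} (A B C : Mat n) : ip (A - B) C = ip A C - ip B C := by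
  simp [ip, Matrix.sub_mul]

theorem ip_smul_left {n : ℕ} (a : ℝ) (A C : Mat n) : ip (a • A) C = a * ip A C := by
  simp [ip]

theorem ip_smul_right {n : ℕ} (a : ℝ) (A C : Mat n) : ip A (a • C) = a * ip A C := by
  simp [ip]

theorem ip_zero_right {n : ℕ} (A : Mat n) : ip A 0 = 0 := by
  simp [ip]

theorem ip_comm {n : ℕ} (A B : Mat n) : ip A B = ip B A := by
  simp [ip, Matrix.trace_mul_comm A B]

theorem aux_W {n : ℕ} (x : ℕ → ℝ) (H : Mat n) (c : ℕ → ℝ) (p r : ℕ) (hp : 1 ≤ p) (hpr : p + 1 < r)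
    (hc : ∀ k, k ≠ p → k ≠ p + 1 → c k = 0)
    (h1 : c p * (x p - x (p-1)) = 1) (h2 : c (p+1) * (x (p+1) - x p) = -1) (j : ℕ) (hj : j < r) :
    Dmat x (fun k => c k • H) r j = (if j = p then -(x (p-1) * c p)
      else if j = p + 1 then -(x (p+1) * c (p+1)) else 0) • H := by
  unfold Dmat
  rw [aux_D_abel x (fun k => c k • H) j r hj]
  have cr : c r = 0 := hc r (by omega) (by omega)
  simp only [cr, smul_smul, smul_zero, zero_smul, zero_sub]
  rw [← Finset.sum_smul, ← neg_smul, ← sub_smul]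
  congr 1
  by_cases e1 : j = p
  · subst e1
    rw [if_pos rfl, Finset.sum_eq_single (j+1)]
    · simp only [Nat.add_sub_cancel]; linear_combination -h1 - h2
    · intro k hk hk'
      rw [Finset.mem_Ico] at hk
      rw [hc k (by omega) hk', mul_zero]
    · intro h; exact absurd (Finset.mem_Ico.mpr ⟨le_rfl, hpr⟩) h
  · rw [if_neg e1]
    by_cases e2 : j = p + 1
    · subst e2
      rw [if_pos rfl, Finset.sum_eq_zero]
      · ring
      · intro k hk
        rw [Finset.mem_Ico] at hk
        rw [hc k (by omega) (by omega), mul_zero]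
    · rw [if_neg e2, hc j e1 e2]
      by_cases e3 : j < p
      · rw [Finset.sum_eq_add p (p+1) (by omega)]
        · simp only [Nat.add_sub_cancel]; linear_combination -h1 - h2
        · intro k _ hk; rw [hc k hk.1 hk.2, mul_zero]
        · intro h; exact absurd (Finset.mem_Ico.mpr ⟨by omega, by omega⟩) h
        · intro h; exact absurd (Finset.mem_Ico.mpr ⟨by omega, by omega⟩) h
      · rw [Finset.sum_eq_zero]
        · ring
        · intro k hk
          rw [Finset.mem_Ico] at hk
          rw [hc k (by omega) (by omega), mul_zero]

theorem aux_crit_ip {n : ℕ} (h : Fin n → ℝ) (β : ℕ → Fin n → ℝ)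
    (hβsum : ∀ j, Summable fun p : ℕ => (2:ℝ) ^ p * β p j ^ 2)
    (Q : Mat n) (hQdiag : ∀ i, Q i i = 1)
    (r : ℕ) (ε : ℝ)
    (x : ℕ → ℝ) (hx : IsStrictSeq r x)
    (Qs : ℕ → Mat n) (hQs : IsStrictTuple Q r Qs)
    (hmin : ∀ Qs' : ℕ → Mat n, IsStrictTuple Q r Qs' →
      CfunEps β h Q r ε x Qs ≤ CfunEps β h Q r ε x Qs')
    (p : ℕ) (hp : 1 ≤ p) (hpr : p + 1 < r) (H : Mat n) (hH : H.IsHermitian) :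
    ip ((1 / x p) • ((Dmat x Qs r p)⁻¹ - (Dmat x Qs r (p+1))⁻¹)
      + (xi'M β (Qs (p+1)) - xi'M β (Qs p)) - ε • (EC x Qs r (p+1) - EC x Qs r p)) H = 0 := by
  have hr : 2 ≤ r := by omega
  have hd1 : 0 < x p - x (p-1) := by
    have := hx.xmono (p-1) (by omega)
    rw [show p - 1 + 1 = p by omega] at this; linarith
  have hd2 : 0 < x (p+1) - x p := by
    have := hx.xmono p (by omega); linarith
  have hxp : 0 < x p := aux_x_pos hx p hp (by omega)
  have hxp1 : 0 < x (p+1) := aux_x_pos hx (p+1) (by omega) (by omega)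
  obtain ⟨c, hcdef⟩ : ∃ c : ℕ → ℝ, c = fun k => if k = p then 1 / (x p - x (p-1))
    else if k = p + 1 then - (1 / (x (p+1) - x p)) else 0 := ⟨_, rfl⟩
  have hc : ∀ k, k ≠ p → k ≠ p + 1 → c k = 0 := by
    intro k h1 h2; simp [hcdef, h1, h2]
  have cp : c p = 1 / (x p - x (p-1)) := by simp [hcdef]
  have cp1 : c (p+1) = - (1 / (x (p+1) - x p)) := by simp [hcdef]
  have h1 : c p * (x p - x (p-1)) = 1 := by rw [cp]; field_simp
  have h2 : c (p+1) * (x (p+1) - x p) = -1 := by rw [cp1]; field_simp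
  have c0 : c 0 = 0 := hc 0 (by omega) (by omega)
  have cr : c r = 0 := hc r (by omega) (by omega)
  have hW := aux_W x H c p r hp hpr hc h1 h2
  have hV : ∀ k, (c k • H).IsHermitian := by
    intro k
    rw [Matrix.IsHermitian, Matrix.conjTranspose_smul, hH.eq]; simp
  have hW1 : Dmat x (fun k => c k • H) r 1 = 0 := by
    rw [hW 1 (by omega)]
    by_cases e : p = 1
    · subst e; simp [hx.x0]
    · rw [if_neg (by omega), if_neg (by omega), zero_smul]
  have hder := aux_deriv h β hβsum Q hQdiag r hr ε x hx Qs hQs (fun k => c k • H) hV hW1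
  have hloc : IsLocalMin (fun t : ℝ => CfunEps β h Q r ε x (fun k => Qs k + t • (c k • H))) 0 := by
    have hev : ∀ᶠ t : ℝ in nhds 0, ∀ k ∈ Finset.range r,
        ((Qs (k+1) - Qs k) + t • (c (k+1) • H - c k • H)).PosDef := by
      rw [Filter.eventually_all_finset]
      intro k hk
      exact aux_posDef _ _ (hQs.inc k (Finset.mem_range.mp hk)) ((hV (k+1)).sub (hV k))
    filter_upwards [hev] with t ht
    simp only [zero_smul, add_zero]
    refine hmin _ ⟨by simp [hQs.Q0, c0], by simp [hQs.Qr, cr], fun k hk => ?_⟩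
    convert! ht k (Finset.mem_range.mpr hk) using 1
    module
  have hz := hloc.hasDerivAt_eq_zero hder
  -- rewrite the sums
  have hfirst : ip (Q - Qs (r-1))⁻¹ (-(c (r-1) • H))
      = ip (Dmat x Qs r (r-1))⁻¹ (Dmat x (fun k => c k • H) r (r-1)) := by
    have e : Finset.Ico (r-1) r = {r-1} := by
      ext k; simp; omega
    simp only [Dmat, e, Finset.sum_singleton, hx.xtop, one_smul, show r - 1 + 1 = r by omega,
      hQs.Qr, cr, zero_smul, zero_sub]
  simp only [hfirst] at hz
  rw [aux_abel1 x (fun k => ip (Dmat x Qs r k)⁻¹ (Dmat x (fun k => c k • H) r k)) hx.x0 r hr,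
    aux_abel2 x (fun k => ip (xi'M β (Qs k)) (c k • H)) hx.x0 r (by omega),
    aux_abel3 (fun k => (Qs (k+1) - Qs k)⁻¹) (fun k => c k • H) (by simp [c0]) r (by omega)] at hz
  rw [aux_sum_two (fun k => (x k - x (k-1)) * ip (xi'M β (Qs k)) (c k • H)) p r hp hpr
      (fun k e1 e2 => by simp [hc k e1 e2, ip]),
    aux_sum_two (fun k => ip ((Qs (k+1) - Qs k)⁻¹ - (Qs (k-1+1) - Qs (k-1))⁻¹) (c k • H)) p r hp hpr
      (fun k e1 e2 => by simp [hc k e1 e2, ip])] at hz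
  have hs1 : ∑ k ∈ Finset.Ico 1 r, ip (Dmat x Qs r k)⁻¹ (Dmat x (fun k => c k • H) r k)
      * (1 / x k - 1 / x (k-1)) =
      ip (Dmat x Qs r p)⁻¹ H * (-(x (p-1) * c p)) * (1 / x p - 1 / x (p-1))
      + ip (Dmat x Qs r (p+1))⁻¹ H * (-(x (p+1) * c (p+1))) * (1 / x (p+1) - 1 / x p) := by
    rw [Finset.sum_eq_add p (p+1) (by omega)]
    · rw [hW p (by omega), hW (p+1) (by omega), if_pos rfl, if_neg (by omega), if_pos rfl,
        ip_smul_right, ip_smul_right]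
      simp only [Nat.add_sub_cancel]
      ring
    · intro k hk hk'
      rw [hW k (Finset.mem_Ico.mp hk).2, if_neg hk'.1, if_neg hk'.2, zero_smul, ip_zero_right, zero_mul]
    · intro h; exact absurd (Finset.mem_Ico.mpr ⟨by omega, by omega⟩) h
    · intro h; exact absurd (Finset.mem_Ico.mpr ⟨by omega, by omega⟩) h
  rw [hs1] at hz
  have hkey : ip (Dmat x Qs r p)⁻¹ H * (-(x (p-1) * c p)) * (1 / x p - 1 / x (p-1))
      + ip (c 1 • H) (Dmat x Qs r 1)⁻¹ = 1 / x p * ip (Dmat x Qs r p)⁻¹ H := by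
    rw [ip_smul_left, ip_comm H]
    by_cases e : p = 1
    · subst e
      rw [cp]; simp [hx.x0]
    · rw [hc 1 (by omega) (by omega), cp]
      have : 0 < x (p-1) := aux_x_pos hx (p-1) (by omega) (by omega)
      field_simp
      ring
  have hkey2 : ip (Dmat x Qs r (p+1))⁻¹ H * (-(x (p+1) * c (p+1))) * (1 / x (p+1) - 1 / x p)
      = - (1 / x p * ip (Dmat x Qs r (p+1))⁻¹ H) := by
    rw [cp1]
    field_simp
    ring
  have hE1 : EC x Qs r p = c p • ((Qs (p+1) - Qs p)⁻¹ - (Qs (p-1+1) - Qs (p-1))⁻¹) := by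
    rw [EC, if_pos ⟨hp, by omega⟩, cp, show p - 1 + 1 = p by omega]
  have hE2 : EC x Qs r (p+1) =
      (- c (p+1)) • ((Qs (p+1+1) - Qs (p+1))⁻¹ - (Qs (p+1-1+1) - Qs (p+1-1))⁻¹) := by
    rw [EC, if_pos ⟨by omega, by omega⟩, cp1, neg_neg]
    simp only [Nat.add_sub_cancel]
  rw [hE1, hE2]
  simp only [ip_sub_left, ip_add_left, ip_smul_left, ip_smul_right, cr, zero_mul, mul_zero,
    zero_sub, Nat.add_sub_cancel] at hz hkey ⊢
  linear_combination 2 * hz - hkey - hkey2 + (ip (xi'M β (Qs p)) H) * h1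
    + (ip (xi'M β (Qs (p+1))) H) * h2

theorem aux_xi'_herm {n : ℕ} (β : ℕ → Fin n → ℝ) (A : Mat n) (hA : A.IsHermitian) :
    (xi'M β A).IsHermitian := by
  ext i j
  have : A j i = A i j := by simpa using hA.apply i j
  simp [xi'M, this, mul_comm (β _ i)]

theorem aux_crit {n : ℕ} (h : Fin n → ℝ) (β : ℕ → Fin n → ℝ)
    (hβsum : ∀ j, Summable fun p : ℕ => (2:ℝ) ^ p * β p j ^ 2)
    (Q : Mat n) (hQdiag : ∀ i, Q i i = 1)
    (r : ℕ) (ε : ℝ)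
    (x : ℕ → ℝ) (hx : IsStrictSeq r x)
    (Qs : ℕ → Mat n) (hQs : IsStrictTuple Q r Qs)
    (hmin : ∀ Qs' : ℕ → Mat n, IsStrictTuple Q r Qs' →
      CfunEps β h Q r ε x Qs ≤ CfunEps β h Q r ε x Qs')
    (p : ℕ) (hp : 1 ≤ p) (hpr : p + 1 < r) :
    (1 / x p) • ((Dmat x Qs r p)⁻¹ - (Dmat x Qs r (p+1))⁻¹)
      + (xi'M β (Qs (p+1)) - xi'M β (Qs p)) - ε • (EC x Qs r (p+1) - EC x Qs r p) = 0 := by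
  have hsm : ∀ (a : ℝ) (A : Mat n), A.IsHermitian → (a • A).IsHermitian := by
    intro a A hA
    rw [Matrix.IsHermitian, Matrix.conjTranspose_smul, hA.eq]; simp
  have hQh : ∀ k, k ≤ r → (Qs k).IsHermitian := fun k hk => by
    simpa [hQs.Q0] using (aux_Q_psd hQs 0 k (by omega) hk).isHermitian
  have hE : ∀ k, 1 ≤ k → k < r → (EC x Qs r k).IsHermitian := by
    intro k h1 h2
    rw [EC, if_pos ⟨h1, by omega⟩]
    refine hsm _ _ (Matrix.IsHermitian.sub (hQs.inc k h2).inv.isHermitian ?_)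
    have := (hQs.inc (k-1) (by omega)).inv.isHermitian
    rwa [show k - 1 + 1 = k by omega] at this
  set M := (1 / x p) • ((Dmat x Qs r p)⁻¹ - (Dmat x Qs r (p+1))⁻¹)
      + (xi'M β (Qs (p+1)) - xi'M β (Qs p)) - ε • (EC x Qs r (p+1) - EC x Qs r p) with hM
  have hMh : M.IsHermitian := by
    refine Matrix.IsHermitian.sub (Matrix.IsHermitian.add (hsm _ _ (Matrix.IsHermitian.sub ?_ ?_))
      (Matrix.IsHermitian.sub ?_ ?_)) (hsm _ _ (Matrix.IsHermitian.sub ?_ ?_))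
    · exact (aux_D_posDef hx hQs p hp (by omega)).inv.isHermitian
    · exact (aux_D_posDef hx hQs (p+1) (by omega) (by omega)).inv.isHermitian
    · exact aux_xi'_herm β _ (hQh _ (by omega))
    · exact aux_xi'_herm β _ (hQh _ (by omega))
    · exact hE _ (by omega) (by omega)
    · exact hE _ (by omega) (by omega)
  have h0 := aux_crit_ip h β hβsum Q hQdiag r ε x hx Qs hQs hmin p hp hpr M hMh
  rw [← hM, ip] at h0
  rw [← Matrix.trace_conjTranspose_mul_self_eq_zero_iff, hMh.eq]
  exact h0

/-- Critical point equations for the barrier-perturbed Crisanti–Sommers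
functional: at a minimizer, `D_p⁻¹ = Λ_p + ε Ē_p` for every `1 ≤ p ≤ r - 1`. -/
theorem perturbedCS_criticalPoint (n : ℕ) (hn : 1 ≤ n) (h : Fin n → ℝ) (β : ℕ → Fin n → ℝ)
    (hβnn : ∀ p j, 0 ≤ β p j)
    (hβodd : ∀ p : ℕ, Odd p → ∀ j, β p j = 0)
    (hβsum : ∀ j, Summable fun p : ℕ => (2:ℝ) ^ p * β p j ^ 2)
    (Q : Mat n) (hQ : Q.PosDef) (hQdiag : ∀ i, Q i i = 1)
    (r : ℕ) (hr : 2 ≤ r) (ε : ℝ) (hε : 0 < ε)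
    (x : ℕ → ℝ) (hx : IsStrictSeq r x)
    (Qs : ℕ → Mat n) (hQs : IsStrictTuple Q r Qs)
    (hmin : ∀ Qs' : ℕ → Mat n, IsStrictTuple Q r Qs' →
      CfunEps β h Q r ε x Qs ≤ CfunEps β h Q r ε x Qs')
    (Λ : Mat n)
    (hΛ : Λ = (Q - Qs (r - 1))⁻¹ + xi'M β Q - xi'M β (Qs (r - 1)) + ε • EC x Qs r (r - 1)) :
    ∀ p, 1 ≤ p → p ≤ r - 1 →
      (Dmat x Qs r p)⁻¹ = Lam β x Qs Λ r p + ε • Ebar x (EC x Qs r) r p := by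
  have hmain : ∀ q p, p + q = r - 1 → 1 ≤ p →
      (Dmat x Qs r p)⁻¹ = Lam β x Qs Λ r p + ε • Ebar x (EC x Qs r) r p := by
    intro q
    induction q with
    | zero =>
      intro p hpq _
      obtain rfl : p = r - 1 := by omega
      have e : Finset.Ico (r-1) r = {r-1} := by
        ext k; simp; omega
      have er : EC x Qs r r = 0 := by
        rw [EC, if_neg (by omega)]
      simp only [Dmat, Lam, Ebar, e, Finset.sum_singleton, hx.xtop, one_smul,
        show r - 1 + 1 = r by omega, hQs.Qr, er, hΛ, zero_sub]
      module
    | succ q ih =>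
      intro p hpq hp
      have h1 := ih (p+1) (by omega) (by omega)
      have h2 := aux_crit h β hβsum Q hQdiag r ε x hx Qs hQs hmin p hp (by omega)
      have hxp : x p ≠ 0 := (aux_x_pos hx p hp (by omega)).ne'
      have h3 : (Dmat x Qs r p)⁻¹ = (Dmat x Qs r (p+1))⁻¹
          - x p • (xi'M β (Qs (p+1)) - xi'M β (Qs p))
          + (x p * ε) • (EC x Qs r (p+1) - EC x Qs r p) := by
        have h4 := congrArg (fun A => x p • A) h2
        simp only [smul_add, smul_sub, smul_smul, smul_zero, mul_one_div_cancel hxp, one_smul] at h4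
        rw [← sub_eq_zero, ← h4]
        module
      rw [h3, h1]
      simp only [Lam, Ebar]
      rw [Finset.sum_eq_sum_Ico_succ_bot (by omega : p < r),
        Finset.sum_eq_sum_Ico_succ_bot (by omega : p < r)]
      module
  intro p hp hpr
  exact hmain (r - 1 - p) p (by omega) hp

end SphericalSG

end
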